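/- arXiv:1307.8429 — 2 statements merged into one kernel-verified Lean document; each statement's English description precedes it below -/
import Mathlib

section
/- Let n > 2 and let c, d be real numbers with c ≠ d such that c ≠ 0, d ≠ 1, d − c ≠ 1, and (c,d) ≠ (1,0). Then P_{n−1}^⊥(T_1) ∩ P_{n−1}^⊥(K_{c,d}) = {0}, the intersection being taken inside the space of bivariate polynomials of total degree ≤ n (each polynomial being determined by its restriction to either triangle). -/
open MeasureTheory Finset

noncomputable section

/-- 2×2 determinant of two vectors in `ℝ²`. -/
def det2 (u v : ℝ × ℝ) : ℝ := u.1 * v.2 - u.2 * v.1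

/-- The open triangle with vertices `A`, `B`, `C` (interior of the convex hull). -/
def tri (A B C : ℝ × ℝ) : Set (ℝ × ℝ) := interior (convexHull ℝ {A, B, C})

/-- Barycentric coordinate of `p` with respect to the vertex `A` of triangle `ABC`. -/
def bary (A B C p : ℝ × ℝ) : ℝ := det2 (p - B) (C - B) / det2 (A - B) (C - B)

/-- The cubic bubble: product of the three barycentric coordinates of triangle `ABC`. -/
def bubble (A B C p : ℝ × ℝ) : ℝ := bary A B C p * bary B C A p * bary C A B p

/-- Evaluation of a bivariate polynomial at a point of `ℝ²`. -/
def evalP (u : MvPolynomial (Fin 2) ℝ) (p : ℝ × ℝ) : ℝ :=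
  MvPolynomial.eval ![p.1, p.2] u

/-- The inner product `(u,v)_K := ∫_K u v ω_K` on the open triangle `K = conv°(A,B,C)`,
with weight the product of the barycentric coordinates. -/
def innerT (A B C : ℝ × ℝ) (u v : MvPolynomial (Fin 2) ℝ) : ℝ :=
  ∫ p in tri A B C, evalP u p * evalP v p * bubble A B C p

/-- `u ∈ P_{n-1}^⊥(K)` for `K = conv°(A,B,C)`: `u` has total degree at most `n` and is
orthogonal to every polynomial of total degree at most `n-1` w.r.t. `(·,·)_K`. -/
def inPerp (n : ℕ) (A B C : ℝ × ℝ) (u : MvPolynomial (Fin 2) ℝ) : Prop :=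
  u.totalDegree ≤ n ∧
    ∀ w : MvPolynomial (Fin 2) ℝ, w.totalDegree ≤ n - 1 → innerT A B C u w = 0

theorem setIntegral_deriv_eq_zero_of_frontier {U : Set ℝ} (hU : IsOpen U) (hc : Convex ℝ U)
    (hb : Bornology.IsBounded U) {g g' : ℝ → ℝ} (hg : ∀ x, HasDerivAt g (g' x) x)
    (hg' : Continuous g') (h0 : ∀ x ∈ frontier U, g x = 0) : ∫ x in U, g' x = 0 := by
  rcases U.eq_empty_or_nonempty with rfl | hne
  · simp
  have hba := hb.bddAbove
  have hbb := hb.bddBelow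
  have hUI : U = Set.Ioo (sInf U) (sSup U) := by
    apply Set.Subset.antisymm
    · rw [← interior_Icc]
      exact interior_maximal (subset_Icc_csInf_csSup hbb hba) hU
    · exact IsConnected.Ioo_csInf_csSup_subset ⟨hne, hc.isPreconnected⟩ hbb hba
  have hle : sInf U ≤ sSup U := Real.sInf_le_sSup U hbb hba
  have ha : sInf U ∈ frontier U := by
    rw [hU.frontier_eq]
    refine ⟨csInf_mem_closure hne hbb, fun h => ?_⟩
    exact lt_irrefl _ (hUI.subset h).1
  have hb' : sSup U ∈ frontier U := by
    rw [hU.frontier_eq]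
    refine ⟨csSup_mem_closure hne hba, fun h => ?_⟩
    exact lt_irrefl _ (hUI.subset h).2
  calc ∫ x in U, g' x = ∫ x in Set.Ioo (sInf U) (sSup U), g' x := by rw [← hUI]
    _ = ∫ x in (sInf U)..(sSup U), g' x := by
      rw [intervalIntegral.integral_of_le hle, integral_Ioc_eq_integral_Ioo]
    _ = 0 := by
      rw [intervalIntegral.integral_eq_sub_of_hasDerivAt (fun x _ => hg x)
        (hg'.intervalIntegrable _ _), h0 _ ha, h0 _ hb', sub_zero]

theorem integrableOn_of_isBounded {S : Set (ℝ × ℝ)} (hb : Bornology.IsBounded S)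
    {F : ℝ × ℝ → ℝ} (hF : Continuous F) : IntegrableOn F S :=
  (hF.continuousOn.integrableOn_compact hb.isCompact_closure).mono_set subset_closure

theorem setIntegral_deriv_fst_eq_zero {S : Set (ℝ × ℝ)} (hS : IsOpen S) (hc : Convex ℝ S)
    (hb : Bornology.IsBounded S) {F F' : ℝ × ℝ → ℝ}
    (hF : ∀ x y, HasDerivAt (fun t => F (t, y)) (F' (x, y)) x) (hF' : Continuous F')
    (h0 : ∀ p ∈ frontier S, F p = 0) : ∫ p in S, F' p = 0 := by
  have hint : Integrable (S.indicator F') ((volume : Measure ℝ).prod volume) :=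
    (integrable_indicator_iff hS.measurableSet).2 (integrableOn_of_isBounded hb hF')
  rw [← integral_indicator hS.measurableSet, Measure.volume_eq_prod, integral_prod_symm _ hint]
  refine integral_eq_zero_of_ae (Filter.Eventually.of_forall fun y => ?_)
  have hcont : Continuous fun x : ℝ => (x, y) := by fun_prop
  have hopen : IsOpen ((fun x : ℝ => (x, y)) ⁻¹' S) := hS.preimage hcont
  change ∫ x, ((fun x : ℝ => (x, y)) ⁻¹' S).indicator (fun x => F' (x, y)) x = 0
  rw [integral_indicator hopen.measurableSet]
  refine setIntegral_deriv_eq_zero_of_frontier hopen ?_ ?_ (fun x => hF x y)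
    (hF'.comp hcont) fun x hx => h0 _ (hcont.frontier_preimage_subset S hx)
  · intro a ha b hb' s t hs ht hst
    have := hc ha hb' hs ht hst
    have hy : s * y + t * y = y := by rw [← add_mul, hst, one_mul]
    simpa [hy] using this
  · exact (Bornology.IsBounded.image_fst hb).subset fun x hx => ⟨(x, y), hx, rfl⟩

theorem setIntegral_deriv_snd_eq_zero {S : Set (ℝ × ℝ)} (hS : IsOpen S) (hc : Convex ℝ S)
    (hb : Bornology.IsBounded S) {F F' : ℝ × ℝ → ℝ}
    (hF : ∀ x y, HasDerivAt (fun t => F (x, t)) (F' (x, y)) y) (hF' : Continuous F')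
    (h0 : ∀ p ∈ frontier S, F p = 0) : ∫ p in S, F' p = 0 := by
  have hint : Integrable (S.indicator F') ((volume : Measure ℝ).prod volume) :=
    (integrable_indicator_iff hS.measurableSet).2 (integrableOn_of_isBounded hb hF')
  rw [← integral_indicator hS.measurableSet, Measure.volume_eq_prod, integral_prod _ hint]
  refine integral_eq_zero_of_ae (Filter.Eventually.of_forall fun x => ?_)
  have hcont : Continuous fun y : ℝ => (x, y) := by fun_prop
  have hopen : IsOpen ((fun y : ℝ => (x, y)) ⁻¹' S) := hS.preimage hcont
  change ∫ y, ((fun y : ℝ => (x, y)) ⁻¹' S).indicator (fun y => F' (x, y)) y = 0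
  rw [integral_indicator hopen.measurableSet]
  refine setIntegral_deriv_eq_zero_of_frontier hopen ?_ ?_ (fun y => hF x y)
    (hF'.comp hcont) fun y hy => h0 _ (hcont.frontier_preimage_subset S hy)
  · intro a ha b hb' s t hs ht hst
    have := hc ha hb' hs ht hst
    have hx : s * x + t * x = x := by rw [← add_mul, hst, one_mul]
    simpa [hx] using this
  · exact (Bornology.IsBounded.image_snd hb).subset fun y hy => ⟨(x, y), hy, rfl⟩

theorem continuous_evalP (p : MvPolynomial (Fin 2) ℝ) : Continuous (evalP p) := by
  unfold evalP
  refine (MvPolynomial.continuous_eval p).comp (continuous_pi fun i => ?_)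
  fin_cases i <;> simp <;> fun_prop

theorem hasDerivAt_evalP_fst (p : MvPolynomial (Fin 2) ℝ) (x y : ℝ) :
    HasDerivAt (fun t => evalP p (t, y)) (evalP (MvPolynomial.pderiv 0 p) (x, y)) x := by
  unfold evalP
  induction p using MvPolynomial.induction_on with
  | C a => simpa using hasDerivAt_const x a
  | add p q hp hq => simpa using hp.fun_add hq
  | mul_X p i hp =>
    fin_cases i
    · simpa [MvPolynomial.pderiv_X, mul_comm, add_comm] using hp.fun_mul (hasDerivAt_id x)
    · simpa [MvPolynomial.pderiv_X, mul_comm] using hp.mul_const y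

theorem hasDerivAt_evalP_snd (p : MvPolynomial (Fin 2) ℝ) (x y : ℝ) :
    HasDerivAt (fun t => evalP p (x, t)) (evalP (MvPolynomial.pderiv 1 p) (x, y)) y := by
  unfold evalP
  induction p using MvPolynomial.induction_on with
  | C a => simpa using hasDerivAt_const y a
  | add p q hp hq => simpa using hp.fun_add hq
  | mul_X p i hp =>
    fin_cases i
    · simpa [MvPolynomial.pderiv_X, mul_comm] using hp.mul_const x
    · simpa [MvPolynomial.pderiv_X, mul_comm, add_comm] using hp.fun_mul (hasDerivAt_id y)

theorem eq_zero_of_evalP_eq_zero_of_isOpen {S : Set (ℝ × ℝ)} (hS : IsOpen S) (hne : S.Nonempty)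
    {p : MvPolynomial (Fin 2) ℝ} (h : ∀ q ∈ S, evalP p q = 0) : p = 0 := by
  obtain ⟨⟨a, b⟩, hab⟩ := hne
  obtain ⟨ε, hε, hball⟩ := Metric.isOpen_iff.1 hS _ hab
  refine MvPolynomial.funext_set ![Metric.ball a ε, Metric.ball b ε] ?_ fun x hx => ?_
  · intro i
    fin_cases i <;> simp only [Real.ball_eq_Ioo] <;> exact Set.Ioo_infinite (by linarith)
  · have h0 := hx 0 (Set.mem_univ _)
    have h1 := hx 1 (Set.mem_univ _)
    have : (x 0, x 1) ∈ S := hball (by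
      rw [← ball_prod_same]
      exact ⟨h0, h1⟩)
    have h2 := h _ this
    have hx' : ![x 0, x 1] = x := by ext i; fin_cases i <;> rfl
    simpa [evalP, hx'] using h2

theorem det2_sub_rotate (A B C : ℝ × ℝ) : det2 (B - C) (A - C) = det2 (A - B) (C - B) := by
  simp only [det2, Prod.fst_sub, Prod.snd_sub]; ring

theorem bary_add_bary_add_bary {A B C : ℝ × ℝ} (h : det2 (A - B) (C - B) ≠ 0) (p : ℝ × ℝ) :
    bary A B C p + bary B C A p + bary C A B p = 1 := by
  unfold bary
  rw [det2_sub_rotate C A B, det2_sub_rotate B C A, det2_sub_rotate A B C, ← add_div, ← add_div,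
    div_eq_one_iff_eq h]
  simp only [det2, Prod.fst_sub, Prod.snd_sub]; ring

theorem bary_smul_add_bary_smul_add_bary_smul {A B C : ℝ × ℝ} (h : det2 (A - B) (C - B) ≠ 0)
    (p : ℝ × ℝ) : bary A B C p • A + bary B C A p • B + bary C A B p • C = p := by
  unfold bary
  rw [det2_sub_rotate C A B, det2_sub_rotate B C A, det2_sub_rotate A B C]
  ext
  · simp only [Prod.fst_add, Prod.smul_fst, smul_eq_mul]
    field_simp
    simp only [det2, Prod.fst_sub, Prod.snd_sub]; ring
  · simp only [Prod.snd_add, Prod.smul_snd, smul_eq_mul]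
    field_simp
    simp only [det2, Prod.fst_sub, Prod.snd_sub]; ring

theorem continuous_bary (A B C : ℝ × ℝ) : Continuous (bary A B C) := by
  unfold bary det2
  fun_prop

theorem bary_nonneg_of_mem_convexHull {A B C p : ℝ × ℝ} (h : det2 (A - B) (C - B) ≠ 0)
    (hp : p ∈ convexHull ℝ {A, B, C}) : 0 ≤ bary A B C p := by
  have hconv : Convex ℝ {q | 0 ≤ bary A B C q} := by
    intro q hq r hr s t hs ht hst
    have : bary A B C (s • q + t • r) = s * bary A B C q + t * bary A B C r := by
      obtain rfl : s = 1 - t := by linarith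
      simp only [bary, det2, Prod.fst_sub, Prod.snd_sub, Prod.fst_add, Prod.snd_add,
        Prod.smul_fst, Prod.smul_snd, smul_eq_mul]
      ring
    simp only [Set.mem_ofPred_eq] at hq hr ⊢
    rw [this]
    positivity
  refine convexHull_min ?_ hconv hp
  rintro q (rfl | rfl | rfl)
  · simp [bary, h]
  · simp [bary, det2]
  · simp [bary, det2, mul_comm]

theorem mem_convexHull_iff_bary_nonneg {A B C p : ℝ × ℝ} (h : det2 (A - B) (C - B) ≠ 0) :
    p ∈ convexHull ℝ {A, B, C} ↔ 0 ≤ bary A B C p ∧ 0 ≤ bary B C A p ∧ 0 ≤ bary C A B p := by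
  refine ⟨fun hp => ⟨bary_nonneg_of_mem_convexHull h hp, bary_nonneg_of_mem_convexHull ?_ ?_,
    bary_nonneg_of_mem_convexHull ?_ ?_⟩, fun ⟨hA, hB, hC⟩ => ?_⟩
  · rwa [det2_sub_rotate]
  · rwa [Set.insert_comm, Set.pair_comm A C] at hp
  · rwa [det2_sub_rotate, det2_sub_rotate]
  · rwa [Set.pair_comm, Set.insert_comm] at hp
  · rw [← bary_smul_add_bary_smul_add_bary_smul h p]
    have hmem : ∀ v ∈ ({A, B, C} : Set (ℝ × ℝ)), v ∈ convexHull ℝ {A, B, C} :=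
      fun v hv => subset_convexHull ℝ _ hv
    have := (convex_convexHull ℝ {A, B, C}).sum_mem (t := Finset.univ)
      (w := ![bary A B C p, bary B C A p, bary C A B p]) (z := ![A, B, C])
      (by intro i _; fin_cases i <;> assumption)
      (by simpa [Fin.sum_univ_three] using bary_add_bary_add_bary h p)
      (by intro i _; fin_cases i <;> exact hmem _ (by simp))
    simpa [Fin.sum_univ_three] using this

theorem mem_tri_of_bary_pos {A B C p : ℝ × ℝ} (h : det2 (A - B) (C - B) ≠ 0)
    (hA : 0 < bary A B C p) (hB : 0 < bary B C A p) (hC : 0 < bary C A B p) :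
    p ∈ tri A B C := by
  have hopen : IsOpen {q | 0 < bary A B C q ∧ 0 < bary B C A q ∧ 0 < bary C A B q} :=
    (isOpen_lt continuous_const (continuous_bary A B C)).inter
      ((isOpen_lt continuous_const (continuous_bary B C A)).inter
        (isOpen_lt continuous_const (continuous_bary C A B)))
  exact interior_maximal (fun q hq => (mem_convexHull_iff_bary_nonneg h).2
    ⟨hq.1.le, hq.2.1.le, hq.2.2.le⟩) hopen ⟨hA, hB, hC⟩

theorem isOpen_tri (A B C : ℝ × ℝ) : IsOpen (tri A B C) := isOpen_interior

theorem convex_tri (A B C : ℝ × ℝ) : Convex ℝ (tri A B C) := (convex_convexHull ℝ _).interior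

theorem isBounded_tri (A B C : ℝ × ℝ) : Bornology.IsBounded (tri A B C) :=
  (isBounded_convexHull.2 (Set.toFinite {A, B, C}).isBounded).subset interior_subset

theorem tri_nonempty {A B C : ℝ × ℝ} (h : det2 (A - B) (C - B) ≠ 0) : (tri A B C).Nonempty := by
  have key : ∀ A B C : ℝ × ℝ, det2 (A - B) (C - B) ≠ 0 →
      bary A B C ((1 / 3 : ℝ) • (A + B + C)) = 1 / 3 := by
    intro A B C h
    rw [bary, div_eq_iff h]
    simp only [det2, Prod.fst_sub, Prod.snd_sub, Prod.fst_add, Prod.snd_add,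
        Prod.smul_fst, Prod.smul_snd, smul_eq_mul]
    ring
  refine ⟨(1 / 3 : ℝ) • (A + B + C), mem_tri_of_bary_pos h ?_ ?_ ?_⟩
  · rw [key A B C h]; norm_num
  · rw [add_assoc, add_comm, key B C A (by rwa [det2_sub_rotate])]; norm_num
  · rw [add_comm, ← add_assoc, key C A B (by rwa [det2_sub_rotate, det2_sub_rotate])]; norm_num

theorem bubble_nonneg_of_mem_tri {A B C p : ℝ × ℝ} (h : det2 (A - B) (C - B) ≠ 0)
    (hp : p ∈ tri A B C) : 0 ≤ bubble A B C p := by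
  obtain ⟨hA, hB, hC⟩ := (mem_convexHull_iff_bary_nonneg h).1 (interior_subset hp)
  exact mul_nonneg (mul_nonneg hA hB) hC

theorem bubble_eq_zero_of_mem_frontier {A B C p : ℝ × ℝ} (h : det2 (A - B) (C - B) ≠ 0)
    (hp : p ∈ frontier (tri A B C)) : bubble A B C p = 0 := by
  have hclosed : IsClosed (convexHull ℝ {A, B, C}) :=
    (Set.toFinite {A, B, C}).isClosed_convexHull ℝ
  rw [(isOpen_tri A B C).frontier_eq] at hp
  have hpH : p ∈ convexHull ℝ {A, B, C} := closure_minimal interior_subset hclosed hp.1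
  obtain ⟨hA, hB, hC⟩ := (mem_convexHull_iff_bary_nonneg h).1 hpH
  by_contra hne
  obtain ⟨hAB, hC'⟩ := mul_ne_zero_iff.1 hne
  obtain ⟨hA', hB'⟩ := mul_ne_zero_iff.1 hAB
  exact hp.2 (mem_tri_of_bary_pos h (hA.lt_of_ne' hA') (hB.lt_of_ne' hB') (hC.lt_of_ne' hC'))

section

open MvPolynomial

theorem evalP_add (p q : MvPolynomial (Fin 2) ℝ) (z : ℝ × ℝ) :
    evalP (p + q) z = evalP p z + evalP q z := map_add _ p q

theorem evalP_sub (p q : MvPolynomial (Fin 2) ℝ) (z : ℝ × ℝ) :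
    evalP (p - q) z = evalP p z - evalP q z := map_sub _ p q

theorem evalP_mul (p q : MvPolynomial (Fin 2) ℝ) (z : ℝ × ℝ) :
    evalP (p * q) z = evalP p z * evalP q z := map_mul _ p q

theorem evalP_C (a : ℝ) (z : ℝ × ℝ) : evalP (C a) z = a := eval_C a

theorem integrableOn_tri_evalP (A B C : ℝ × ℝ) (p : MvPolynomial (Fin 2) ℝ) :
    IntegrableOn (evalP p) (tri A B C) :=
  integrableOn_of_isBounded (isBounded_tri A B C) (continuous_evalP p)

theorem setIntegral_tri_pderiv_eq_zero {A B C : ℝ × ℝ} (h : det2 (A - B) (C - B) ≠ 0)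
    {W : MvPolynomial (Fin 2) ℝ} (hW : ∀ p, evalP W p = bubble A B C p)
    (i : Fin 2) (G : MvPolynomial (Fin 2) ℝ) :
    ∫ p in tri A B C, evalP (pderiv i (W * G)) p = 0 := by
  have h0 : ∀ p ∈ frontier (tri A B C), evalP (W * G) p = 0 := fun p hp => by
    rw [evalP_mul, hW, bubble_eq_zero_of_mem_frontier h hp, zero_mul]
  fin_cases i
  · exact setIntegral_deriv_fst_eq_zero (isOpen_tri A B C) (convex_tri A B C)
      (isBounded_tri A B C) (hasDerivAt_evalP_fst _) (continuous_evalP _) h0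
  · exact setIntegral_deriv_snd_eq_zero (isOpen_tri A B C) (convex_tri A B C)
      (isBounded_tri A B C) (hasDerivAt_evalP_snd _) (continuous_evalP _) h0

theorem innerT_eq_setIntegral_evalP {A B C : ℝ × ℝ}
    {W : MvPolynomial (Fin 2) ℝ} (hW : ∀ p, evalP W p = bubble A B C p)
    (u v : MvPolynomial (Fin 2) ℝ) :
    innerT A B C u v = ∫ p in tri A B C, evalP (W * (u * v)) p := by
  simp only [innerT, evalP_mul, hW, mul_comm]

theorem eq_zero_of_innerT_self_eq_zero {A B C : ℝ × ℝ} (h : det2 (A - B) (C - B) ≠ 0)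
    {W : MvPolynomial (Fin 2) ℝ} (hW : ∀ p, evalP W p = bubble A B C p) (hW0 : W ≠ 0)
    {u : MvPolynomial (Fin 2) ℝ} (hu : innerT A B C u u = 0) : u = 0 := by
  rw [innerT_eq_setIntegral_evalP hW] at hu
  rw [setIntegral_eq_zero_iff_of_nonneg_ae _ (integrableOn_tri_evalP A B C _)] at hu
  · have heq := Measure.eqOn_open_of_ae_eq hu (isOpen_tri A B C)
      (continuous_evalP _).continuousOn continuousOn_const
    have := eq_zero_of_evalP_eq_zero_of_isOpen (isOpen_tri A B C) (tri_nonempty h) heq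
    simpa [hW0] using this
  · refine (ae_restrict_iff' (isOpen_tri A B C).measurableSet).2
      (Filter.Eventually.of_forall fun p hp => ?_)
    rw [evalP_mul, evalP_mul, hW]
    exact mul_nonneg (bubble_nonneg_of_mem_tri h hp) (mul_self_nonneg _)

theorem pderiv_pderiv_comm (i j : Fin 2) (u : MvPolynomial (Fin 2) ℝ) :
    pderiv i (pderiv j u) = pderiv j (pderiv i u) := by
  induction u using MvPolynomial.induction_on with
  | C a => simp
  | add p q hp hq => simp [hp, hq]
  | mul_X p k hp =>
    simp only [Derivation.leibniz, map_add, smul_eq_mul, hp, pderiv_X, Pi.single_apply]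
    split_ifs <;> simp <;> ring

/-- The bubble, as a polynomial, of the triangle with vertices `(0, 0)`, `(1, 0)` and
`(-r / s, 1 / s)`. -/
def bubblePoly (r s : ℝ) : MvPolynomial (Fin 2) ℝ :=
  (1 - X 0 - C r * X 1 - C s * X 1) * (X 0 + C r * X 1) * (C s * X 1)

/-- The Jacobi-type differential operator on the triangle with vertices `(0, 0)`, `(1, 0)` and
`(-r * b, b)`, symmetric with respect to the weighted inner product. -/
def jacobiOp (r b : ℝ) (u : MvPolynomial (Fin 2) ℝ) : MvPolynomial (Fin 2) ℝ :=
  (X 0 + C (r + r ^ 2 * b) * X 1 - X 0 ^ 2) * pderiv 0 (pderiv 0 u)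
    - 2 * (C (r * b) * X 1 + X 0 * X 1) * pderiv 0 (pderiv 1 u)
    + (C b * X 1 - X 1 ^ 2) * pderiv 1 (pderiv 1 u)
    + (C (2 * (1 - r * b)) - 6 * X 0) * pderiv 0 u + (C (2 * b) - 6 * X 1) * pderiv 1 u

theorem bubblePoly_mul_jacobiOp_sub {r s b : ℝ} (hsb : s * b = 1)
    (u w : MvPolynomial (Fin 2) ℝ) :
    bubblePoly r s * (jacobiOp r b u * w - u * jacobiOp r b w) =
      pderiv 0 (bubblePoly r s *
        ((X 0 + C (r + r ^ 2 * b) * X 1 - X 0 ^ 2) * (pderiv 0 u * w - u * pderiv 0 w)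
          - (C (r * b) * X 1 + X 0 * X 1) * (pderiv 1 u * w - u * pderiv 1 w)))
      + pderiv 1 (bubblePoly r s *
        ((C b * X 1 - X 1 ^ 2) * (pderiv 1 u * w - u * pderiv 1 w)
          - (C (r * b) * X 1 + X 0 * X 1) * (pderiv 0 u * w - u * pderiv 0 w))) := by
  have hC : (C s * C b : MvPolynomial (Fin 2) ℝ) = 1 := by rw [← C_mul, hsb, C_1]
  have h2 : (C 2 : MvPolynomial (Fin 2) ℝ) = 2 := rfl
  unfold bubblePoly jacobiOp
  simp only [Derivation.leibniz, Derivation.leibniz_pow, map_add, map_sub, smul_eq_mul,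
    pderiv_C, pderiv_X_self, pderiv_X_of_ne (show (1 : Fin 2) ≠ 0 by decide),
    pderiv_X_of_ne (show (0 : Fin 2) ≠ 1 by decide), pderiv_one, C_mul, C_pow, C_1, h2,
    pderiv_pderiv_comm 1 0, nsmul_eq_mul, Nat.cast_ofNat]
  generalize pderiv 0 (pderiv 0 u) = u00
  generalize pderiv 0 (pderiv 1 u) = u01
  generalize pderiv 1 (pderiv 1 u) = u11
  generalize pderiv 0 (pderiv 0 w) = w00
  generalize pderiv 0 (pderiv 1 w) = w01
  generalize pderiv 1 (pderiv 1 w) = w11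
  generalize pderiv 0 u = u0
  generalize pderiv 1 u = u1
  generalize pderiv 0 w = w0
  generalize pderiv 1 w = w1
  linear_combination (-C s * (X 0 + C r * X 1) * X 1 ^ 2 *
    (C r * (u0 * w - u * w0) - (u1 * w - u * w1))) * hC

theorem innerT_jacobiOp_comm {A B C : ℝ × ℝ} (h : det2 (A - B) (C - B) ≠ 0) {r s b : ℝ}
    (hsb : s * b = 1) (hW : ∀ p, evalP (bubblePoly r s) p = bubble A B C p)
    (u w : MvPolynomial (Fin 2) ℝ) :
    innerT A B C (jacobiOp r b u) w = innerT A B C u (jacobiOp r b w) := by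
  rw [← sub_eq_zero, innerT_eq_setIntegral_evalP hW, innerT_eq_setIntegral_evalP hW,
    ← integral_sub (integrableOn_tri_evalP A B C _) (integrableOn_tri_evalP A B C _)]
  simp only [← evalP_sub, ← mul_sub]
  rw [bubblePoly_mul_jacobiOp_sub hsb]
  simp only [evalP_add]
  rw [integral_add (integrableOn_tri_evalP A B C _) (integrableOn_tri_evalP A B C _),
    setIntegral_tri_pderiv_eq_zero h hW, setIntegral_tri_pderiv_eq_zero h hW, add_zero]

theorem coeff_pderiv_fst (u : MvPolynomial (Fin 2) ℝ) (i j : ℕ) :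
    coeff (.single 0 i + .single 1 j) (pderiv 0 u)
      = (i + 1) * coeff (.single 0 (i + 1) + .single 1 j) u := by
  rw [coeff_pderiv, add_right_comm, ← Finsupp.single_add]
  simp [mul_comm]

theorem coeff_pderiv_snd (u : MvPolynomial (Fin 2) ℝ) (i j : ℕ) :
    coeff (.single 0 i + .single 1 j) (pderiv 1 u)
      = (j + 1) * coeff (.single 0 i + .single 1 (j + 1)) u := by
  rw [coeff_pderiv, add_assoc, ← Finsupp.single_add]
  simp [mul_comm]

theorem coeff_X_mul_fst (u : MvPolynomial (Fin 2) ℝ) (i j : ℕ) :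
    coeff (.single 0 (i + 1) + .single 1 j) (X 0 * u) = coeff (.single 0 i + .single 1 j) u := by
  rw [Finsupp.single_add, add_comm (Finsupp.single 0 i), add_assoc, coeff_X_mul]

theorem coeff_X_mul_snd (u : MvPolynomial (Fin 2) ℝ) (i j : ℕ) :
    coeff (.single 0 i + .single 1 (j + 1)) (X 1 * u) = coeff (.single 0 i + .single 1 j) u := by
  rw [Finsupp.single_add, add_comm (Finsupp.single 1 j), add_left_comm, coeff_X_mul]

theorem coeff_X_mul_snd_zero (u : MvPolynomial (Fin 2) ℝ) (i : ℕ) :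
    coeff (.single 0 i + .single 1 0) (X 1 * u) = 0 := by
  rw [coeff_X_mul', if_neg (by simp)]

theorem coeff_X_mul_pderiv_fst (u : MvPolynomial (Fin 2) ℝ) (i j : ℕ) :
    coeff (.single 0 i + .single 1 j) (X 0 * pderiv 0 u)
      = i * coeff (.single 0 i + .single 1 j) u := by
  cases i with
  | zero => rw [coeff_X_mul', if_neg (by simp)]; simp
  | succ i => rw [coeff_X_mul_fst, coeff_pderiv_fst]; push_cast; rfl

theorem coeff_X_mul_pderiv_snd (u : MvPolynomial (Fin 2) ℝ) (i j : ℕ) :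
    coeff (.single 0 i + .single 1 j) (X 1 * pderiv 1 u)
      = j * coeff (.single 0 i + .single 1 j) u := by
  cases j with
  | zero => rw [coeff_X_mul_snd_zero]; simp
  | succ j => rw [coeff_X_mul_snd, coeff_pderiv_snd]; push_cast; rfl

theorem coeff_jacobiOp (r b : ℝ) (u : MvPolynomial (Fin 2) ℝ) (i j : ℕ) :
    coeff (.single 0 i + .single 1 j) (jacobiOp r b u) =
      (i + 1) * (i + 2) * coeff (.single 0 (i + 1) + .single 1 j) u
      + (r + r ^ 2 * b) * coeff (.single 0 i + .single 1 j) (X 1 * pderiv 0 (pderiv 0 u))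
      - 2 * (r * b) * (i + 1) * (j + 1) * coeff (.single 0 (i + 1) + .single 1 j) u
      + b * (j + 1) * (j + 2) * coeff (.single 0 i + .single 1 (j + 1)) u
      - (i + j) * (i + j + 5) * coeff (.single 0 i + .single 1 j) u := by
  have h2 : (C 2 : MvPolynomial (Fin 2) ℝ) = 2 := rfl
  have h : jacobiOp r b u = X 0 * pderiv 0 (pderiv 0 u)
      + C (r + r ^ 2 * b) * (X 1 * pderiv 0 (pderiv 0 u))
      - C (2 * (r * b)) * (X 1 * pderiv 1 (pderiv 0 u)) + C b * (X 1 * pderiv 1 (pderiv 1 u))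
      + C (2 * (1 - r * b)) * pderiv 0 u + C (2 * b) * pderiv 1 u
      - X 0 * pderiv 0 (X 0 * pderiv 0 u) - C 2 * (X 0 * pderiv 0 (X 1 * pderiv 1 u))
      - X 1 * pderiv 1 (X 1 * pderiv 1 u) - C 5 * (X 0 * pderiv 0 u)
      - C 5 * (X 1 * pderiv 1 u) := by
    have h5 : (C 5 : MvPolynomial (Fin 2) ℝ) = 5 := rfl
    simp only [jacobiOp, Derivation.leibniz, smul_eq_mul, pderiv_X_self, C_mul, h2, h5,
      pderiv_X_of_ne (show (1 : Fin 2) ≠ 0 by decide), pderiv_pderiv_comm 1 0]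
    ring
  rw [h]
  simp only [coeff_add, coeff_sub, coeff_C_mul, coeff_X_mul_pderiv_fst, coeff_X_mul_pderiv_snd,
    coeff_pderiv_fst, coeff_pderiv_snd]
  ring

theorem single_add_single_eq (m : Fin 2 →₀ ℕ) : .single 0 (m 0) + .single 1 (m 1) = m := by
  ext k
  fin_cases k <;> simp

theorem coeff_eq_zero_of_totalDegree_lt_add {u : MvPolynomial (Fin 2) ℝ} {i j : ℕ}
    (h : u.totalDegree < i + j) : coeff (.single 0 i + .single 1 j) u = 0 :=
  coeff_eq_zero_of_totalDegree_lt <| by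
    change _ < (Finsupp.single (0 : Fin 2) i + Finsupp.single 1 j).sum fun _ e => e
    rw [Finsupp.sum_fintype _ _ fun _ => rfl, Fin.sum_univ_two]
    simpa using h

theorem totalDegree_le_of_coeff_eq_zero {u : MvPolynomial (Fin 2) ℝ} {n : ℕ}
    (h : ∀ i j, n < i + j → coeff (.single 0 i + .single 1 j) u = 0) : u.totalDegree ≤ n := by
  refine Finset.sup_le fun m hm => ?_
  rw [Finsupp.sum_fintype _ _ fun _ => rfl, Fin.sum_univ_two]
  by_contra! hlt
  refine mem_support_iff.1 hm ?_
  rw [← single_add_single_eq m]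
  exact h _ _ hlt

theorem coeff_X_mul_snd_pderiv_fst_pderiv_fst_eq_zero {u : MvPolynomial (Fin 2) ℝ} {i j : ℕ}
    (h : u.totalDegree < i + j + 1) :
    coeff (.single 0 i + .single 1 j) (X 1 * pderiv 0 (pderiv 0 u)) = 0 := by
  cases j with
  | zero => exact coeff_X_mul_snd_zero _ _
  | succ j =>
    rw [coeff_X_mul_snd, coeff_pderiv_fst, coeff_pderiv_fst,
      coeff_eq_zero_of_totalDegree_lt_add (by lia), mul_zero, mul_zero]

theorem coeff_jacobiOp_of_totalDegree_le {u : MvPolynomial (Fin 2) ℝ} (r b : ℝ) {i j : ℕ}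
    (h : u.totalDegree ≤ i + j) : coeff (.single 0 i + .single 1 j) (jacobiOp r b u)
      = -((i + j) * (i + j + 5)) * coeff (.single 0 i + .single 1 j) u := by
  rw [coeff_jacobiOp, coeff_X_mul_snd_pderiv_fst_pderiv_fst_eq_zero (by lia),
    coeff_eq_zero_of_totalDegree_lt_add (i := i + 1) (by lia),
    coeff_eq_zero_of_totalDegree_lt_add (j := j + 1) (by lia)]
  ring

theorem totalDegree_jacobiOp_le (r b : ℝ) (u : MvPolynomial (Fin 2) ℝ) :
    (jacobiOp r b u).totalDegree ≤ u.totalDegree :=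
  totalDegree_le_of_coeff_eq_zero fun i j h => by
    rw [coeff_jacobiOp_of_totalDegree_le r b h.le, coeff_eq_zero_of_totalDegree_lt_add h, mul_zero]

theorem jacobiOp_eq_of_inPerp {A B D : ℝ × ℝ} (h : det2 (A - B) (D - B) ≠ 0) {r s b : ℝ}
    (hsb : s * b = 1) (hW : ∀ p, evalP (bubblePoly r s) p = bubble A B D p)
    (hW0 : bubblePoly r s ≠ 0) {n : ℕ} (hn : 0 < n)
    {u : MvPolynomial (Fin 2) ℝ}
    (hu : inPerp n A B D u) : jacobiOp r b u + C (n * (n + 5) : ℝ) * u = 0 := by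
  obtain ⟨hdeg, horth⟩ := hu
  set v := jacobiOp r b u + C (n * (n + 5) : ℝ) * u with hv
  have hvdeg : v.totalDegree ≤ n - 1 := by
    refine totalDegree_le_of_coeff_eq_zero fun i j hij => ?_
    rw [hv, coeff_add, coeff_C_mul, coeff_jacobiOp_of_totalDegree_le r b (by lia)]
    rcases (show n ≤ i + j by lia).eq_or_lt with rfl | hlt
    · push_cast; ring
    · rw [coeff_eq_zero_of_totalDegree_lt_add (by lia)]; ring
  refine eq_zero_of_innerT_self_eq_zero h hW hW0 ?_
  have hadd : innerT A B D v v = innerT A B D (jacobiOp r b u) v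
      + n * (n + 5) * innerT A B D u v := by
    simp only [innerT_eq_setIntegral_evalP hW]
    rw [← integral_const_mul, ← integral_add (integrableOn_tri_evalP A B D _)
      ((integrableOn_tri_evalP A B D _).const_mul _)]
    congr 1
    ext p
    have hvp : evalP v p = evalP (jacobiOp r b u) p + n * (n + 5) * evalP u p := by
      rw [hv, evalP_add, evalP_mul, evalP_C]
    simp only [evalP_mul, hvp]
    ring
  rw [hadd, innerT_jacobiOp_comm h hsb hW, horth v hvdeg,
    horth _ ((totalDegree_jacobiOp_le r b v).trans hvdeg)]
  simp

theorem coeff_relation_of_jacobiOp_eq {r b l : ℝ} {u : MvPolynomial (Fin 2) ℝ}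
    (h : jacobiOp r b u + C l * u = 0) (i j : ℕ) :
    (i + 1) * (i + 2) * coeff (.single 0 (i + 1) + .single 1 j) u
      + (r + r ^ 2 * b) * coeff (.single 0 i + .single 1 j) (X 1 * pderiv 0 (pderiv 0 u))
      - 2 * (r * b) * (i + 1) * (j + 1) * coeff (.single 0 (i + 1) + .single 1 j) u
      + b * (j + 1) * (j + 2) * coeff (.single 0 i + .single 1 (j + 1)) u
      = ((i + j) * (i + j + 5) - l) * coeff (.single 0 i + .single 1 j) u := by
  have h' := congrArg (coeff (.single 0 i + .single 1 j)) h
  rw [coeff_add, coeff_jacobiOp, coeff_C_mul, coeff_zero] at h'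
  linear_combination h'

theorem bubblePoly_ne_zero (r : ℝ) {s : ℝ} (hs : s ≠ 0) : bubblePoly r s ≠ 0 := by
  intro h
  have h1 : evalP (bubblePoly r s) (1 - r, 1) = 0 := by rw [h]; exact map_zero _
  simp [evalP, bubblePoly, hs] at h1

theorem evalP_bubblePoly (r s : ℝ) (p : ℝ × ℝ) : evalP (bubblePoly r s) p =
    (1 - p.1 - r * p.2 - s * p.2) * (p.1 + r * p.2) * (s * p.2) := by
  simp [evalP, bubblePoly]

theorem evalP_bubblePoly_unit (p : ℝ × ℝ) :
    evalP (bubblePoly 0 1) p = bubble (0, 0) (1, 0) (0, 1) p := by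
  rw [evalP_bubblePoly]
  simp only [bubble, bary, det2, Prod.fst_sub, Prod.snd_sub]
  ring

theorem evalP_bubblePoly_adjacent {c d : ℝ} (hcd : c ≠ d) (p : ℝ × ℝ) :
    evalP (bubblePoly c (d - c)) p =
      bubble (1, 0) (0, 0) (-c / (d - c), 1 / (d - c)) p := by
  have h : d - c ≠ 0 := sub_ne_zero.2 hcd.symm
  generalize d - c = s at h ⊢
  rw [evalP_bubblePoly]
  unfold bubble bary
  rw [det2_sub_rotate (0, 0) (-c / s, 1 / s) (1, 0), det2_sub_rotate (1, 0) (0, 0),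
    show det2 ((1, 0) - (0, 0)) ((-c / s, 1 / s) - (0, 0)) = 1 / s by
      simp [det2]]
  simp only [det2, Prod.fst_sub, Prod.snd_sub]
  field_simp
  ring

/-- A sequence annihilated both by `A + B * t + D * t ^ 2` and by
`2 * A + B * t + B * t ^ 2 + 2 * D * t ^ 3` (with `t` acting as the shift) and vanishing
at the first place vanishes at the second place as well. -/
theorem eq_zero_of_shift_relations {c d w₁ w₂ w₃ w₄ : ℝ} (hcd : c ≠ d) (hc : c ≠ 0) (hd : d ≠ 1)
    (h1 : d - c ≠ 1) (h10 : ¬(c = 1 ∧ d = 0))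
    (hQ0 : 2 * c * w₁ + (d - c - 1) * w₂ = 0)
    (hQ1 : -(c * d) * w₁ + 2 * c * w₂ + (d - c - 1) * w₃ = 0)
    (hQ2 : -(c * d) * w₂ + 2 * c * w₃ + (d - c - 1) * w₄ = 0)
    (hC0 : 2 * c * w₁ + 2 * c * w₂ + 2 * (d - c - 1) * w₃ = 0)
    (hC1 : -2 * (c * d) * w₁ + 2 * c * w₂ + 2 * c * w₃ + 2 * (d - c - 1) * w₄ = 0) :
    w₁ = 0 := by
  by_contra hw
  obtain ⟨A, hA⟩ : ∃ A, A = -(c * d) := ⟨_, rfl⟩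
  obtain ⟨B, hB⟩ : ∃ B, B = 2 * c := ⟨_, rfl⟩
  obtain ⟨D, hD⟩ : ∃ D, D = d - c - 1 := ⟨_, rfl⟩
  have hB0 : B ≠ 0 := by rw [hB]; simpa using hc
  have hD0 : D ≠ 0 := by rw [hD]; exact sub_ne_zero.2 h1
  have e1 : B * D - 2 * A * D + B ^ 2 = 0 := by
    refine (mul_eq_zero.1 (?_ : _ * w₁ = 0)).resolve_right hw
    subst hA hB hD
    linear_combination (d - c - 1) * hC0 - 2 * (d - c - 1) * hQ1 + 2 * c * hQ0
  have e2 : 2 * A * D ^ 2 - B ^ 2 * D + 3 * A * B * D - B ^ 3 = 0 := by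
    refine (mul_eq_zero.1 (?_ : _ * w₁ = 0)).resolve_right hw
    subst hA hB hD
    linear_combination (d - c - 1) ^ 2 * hC1 - 2 * (d - c - 1) ^ 2 * hQ2 +
      (2 * c) * (d - c - 1) * hQ1
      + (-(2 * c) * (2 * c) - (d - c - 1) * (2 * c + 2 * (c * d))) * hQ0
  have e3 : A + B + D = 0 := by
    have : B * D * (A + B + D) = 0 := by linear_combination e2 + (D + B) * e1
    exact (mul_eq_zero.1 this).resolve_left (mul_ne_zero hB0 hD0)
  have hc1 : c = 1 := by
    have : (c - 1) * (1 - d) = 0 := by subst hA hB hD; linear_combination e3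
    exact sub_eq_zero.1 ((mul_eq_zero.1 this).resolve_right (sub_ne_zero.2 hd.symm))
  have hA0 : A * (B + 2 * D) = 0 := by linear_combination B * e3 - e1
  subst hA hB hD hc1
  rcases mul_eq_zero.1 hA0 with h | h
  · exact h10 ⟨rfl, by linarith⟩
  · exact hd (by linarith)

theorem coeff_top_eq_zero_of_relations {c d κ : ℝ} (hcd : c ≠ d) (hc : c ≠ 0) (hd : d ≠ 1)
    (h1 : d - c ≠ 1) (h10 : ¬(c = 1 ∧ d = 0)) {a : ℕ → ℕ → ℝ} {k : ℕ}
    (hT : ∀ i j : ℕ, i + j = k + 2 →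
      (i + 1) * (i + 2) * a (i + 1) j + (j + 1) * (j + 2) * a i (j + 1) = κ * a i j)
    (hQ0 : ∀ i : ℕ, 2 * c * (i + 1) * a (i + 1) 0 + 2 * (d - c - 1) * a i 1 = 0)
    (hQ : ∀ i j : ℕ, -(c * d) * (i + 1) * (i + 2) * a (i + 2) j
      + 2 * c * (i + 1) * (j + 2) * a (i + 1) (j + 1)
      + (d - c - 1) * (j + 2) * (j + 3) * a i (j + 2) = 0) :
    ∀ j i, i + j = k + 3 → a i j = 0 := by
  have hD0 : d - c - 1 ≠ 0 := sub_ne_zero.2 h1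
  have h0 : a (k + 3) 0 = 0 := by
    have Q0 := hQ0 (k + 2)
    have Q1 := hQ (k + 1) 0
    have Q2 := hQ k 1
    have q0 := hQ0 (k + 1)
    have q1 := hQ k 0
    have t0 := hT (k + 2) 0 rfl
    have t1 := hT (k + 1) 1 rfl
    have t2 := hT k 2 rfl
    push_cast at Q0 Q1 Q2 q0 q1 t0 t1 t2
    simp only [zero_add, add_assoc] at Q0 Q1 Q2 q0 q1 t0 t1 t2
    norm_num at Q0 Q1 Q2 q0 q1 t0 t1 t2
    have hw := eq_zero_of_shift_relations (w₁ := (k + 3) * (k + 2) * (k + 1) * a (k + 3) 0)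
      (w₂ := 2 * (k + 2) * (k + 1) * a (k + 2) 1) (w₃ := 6 * (k + 1) * a (k + 1) 2)
      (w₄ := 24 * a k 3) hcd hc hd h1 h10
      (by linear_combination (k + 2) * (k + 1) * Q0)
      (by linear_combination (k + 1) * Q1)
      (by linear_combination 2 * Q2)
      (by linear_combination (k + 1) * κ * q0 + 2 * c * (k + 2) * (k + 1) * t0
            + 2 * (d - c - 1) * (k + 1) * t1 - (k + 3) * (k + 2) * (k + 1) * Q0)
      (by linear_combination κ * q1 - c * d * (k + 2) * (k + 1) * t0 + 4 * c * (k + 1) * t1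
            + 6 * (d - c - 1) * t2 - (k + 2) * (k + 1) * Q1 - 2 * Q2)
    have hk : ((k + 3) * (k + 2) * (k + 1) : ℝ) ≠ 0 := by positivity
    exact (mul_eq_zero.1 hw).resolve_left hk
  intro j
  induction j using Nat.twoStepInduction with
  | zero => rintro i rfl; exact h0
  | one =>
    intro i hi
    have := hQ0 i
    rw [show i + 1 = k + 3 from hi, h0] at this
    simpa [hD0] using this
  | more j ih ih' =>
    intro i hi
    have := hQ i j
    rw [ih (i + 2) (by lia), ih' (i + 1) (by lia)] at this
    have h2 : (j + 2 : ℝ) ≠ 0 := by positivity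
    have h3 : (j + 3 : ℝ) ≠ 0 := by positivity
    simpa [hD0, h2, h3] using this

end

/-- For `n > 2` and reals `c ≠ d` with `c ≠ 0`, `d ≠ 1`, `d - c ≠ 1` and
`(c,d) ≠ (1,0)`, the intersection `P_{n-1}^⊥(T₁) ∩ P_{n-1}^⊥(K_{c,d})` is `{0}`, where
`T₁ = conv°((0,0),(1,0),(0,1))` and `K_{c,d} = conv°((1,0),(0,0),(-c/(d-c), 1/(d-c)))`. -/
theorem statement3 (n : ℕ) (hn : 2 < n) (c d : ℝ) (hcd : c ≠ d)
    (hc : c ≠ 0) (hd : d ≠ 1) (h1 : d - c ≠ 1) (h10 : ¬(c = 1 ∧ d = 0))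
    (u : MvPolynomial (Fin 2) ℝ)
    (hT : inPerp n (0, 0) (1, 0) (0, 1) u)
    (hK : inPerp n (1, 0) (0, 0) (-c / (d - c), 1 / (d - c)) u) :
    u = 0 := by
  have hdc : d - c ≠ 0 := sub_ne_zero.2 hcd.symm
  have hΔT : det2 ((0, 0) - (1, 0)) ((0, 1) - (1, 0)) ≠ 0 := by simp [det2]
  have hΔK : det2 ((1, 0) - (0, 0)) ((-c / (d - c), 1 / (d - c)) - (0, 0)) ≠ 0 := by
    simp [det2, hdc]
  have eT := jacobiOp_eq_of_inPerp hΔT (mul_one 1) evalP_bubblePoly_unit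
    (bubblePoly_ne_zero 0 one_ne_zero) (by lia) hT
  have eK := jacobiOp_eq_of_inPerp hΔK (mul_inv_cancel₀ hdc) (evalP_bubblePoly_adjacent hcd)
    (bubblePoly_ne_zero c hdc) (by lia) hK
  obtain ⟨k, rfl⟩ : ∃ k, n = k + 3 := ⟨n - 3, by lia⟩
  have relT := coeff_relation_of_jacobiOp_eq eT
  have relK := coeff_relation_of_jacobiOp_eq eK
  have htop := coeff_top_eq_zero_of_relations (k := k)
    (a := fun i j => MvPolynomial.coeff (.single 0 i + .single 1 j) u)
    (κ := (k + 2) * (k + 2 + 5) - (k + 3) * (k + 3 + 5)) hcd hc hd h1 h10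
    (fun i j hij => by
      have h := relT i j
      have hij' : (i : ℝ) + j = k + 2 := by exact_mod_cast hij
      rw [hij'] at h
      push_cast at h
      linear_combination h)
    (fun i => by
      have hT := relT i 0
      have hK := relK i 0
      rw [coeff_X_mul_snd_zero] at hT hK
      field_simp at hK
      push_cast at hT hK
      linear_combination (d - c) * hT - hK)
    (fun i j => by
      have hT := relT i (j + 1)
      have hK := relK i (j + 1)
      rw [coeff_X_mul_snd, coeff_pderiv_fst, coeff_pderiv_fst] at hT hK
      field_simp at hK
      push_cast at hT hK
      linear_combination (d - c) * hT - hK)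
  have hdeg : u.totalDegree ≤ k + 3 - 1 :=
    totalDegree_le_of_coeff_eq_zero fun i j hij => by
      rcases (show k + 3 ≤ i + j by lia).eq_or_lt with h | h
      · exact htop j i h.symm
      · exact coeff_eq_zero_of_totalDegree_lt_add (hT.1.trans_lt h)
  exact eq_zero_of_innerT_self_eq_zero hΔT evalP_bubblePoly_unit
    (bubblePoly_ne_zero 0 one_ne_zero) (hT.2 u hdeg)
end
end

section
/- Let c, d be real numbers with c ≠ d such that c ≠ 0, d ≠ 1, d − c ≠ 1, and d − c ≠ −1. Then P_1^⊥(T_1) ∩ P_1^⊥(K_{c,d}) = {0}, the intersection being taken inside the space of bivariate polynomials of total degree ≤ 2. -/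
open MeasureTheory Finset

noncomputable section

theorem convexHull_standard_triangle :
    convexHull ℝ {((0 : ℝ), (0 : ℝ)), (1, 0), (0, 1)} =
      {p : ℝ × ℝ | p.1 ∈ Set.Icc 0 1 ∧ p.2 ∈ Set.Icc 0 (1 - p.1)} := by
  apply Set.Subset.antisymm
  · apply convexHull_min
    · rintro p (rfl | rfl | rfl) <;> norm_num
    · rintro ⟨x, y⟩ ⟨⟨hx0, hx1⟩, hy0, hy1⟩ ⟨x', y'⟩ ⟨⟨hx0', hx1'⟩, hy0', hy1'⟩ a b ha hb hab
      simp only [Set.mem_ofPred_eq, Set.mem_Icc, Prod.smul_mk, Prod.mk_add_mk, smul_eq_mul] at *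
      refine ⟨⟨by positivity, by nlinarith⟩, by positivity, by nlinarith⟩
  · rintro ⟨x, y⟩ ⟨⟨hx0, hx1⟩, hy0, hy1⟩
    simp only at hx0 hx1 hy0 hy1
    have h := (convex_convexHull ℝ {((0 : ℝ), (0 : ℝ)), (1, 0), (0, 1)}).sum_mem
      (t := univ) (w := ![1 - x - y, x, y])
      (z := ![((0 : ℝ), (0 : ℝ)), (1, 0), (0, 1)])
      (by intro i _; fin_cases i <;> simp <;> linarith)
      (by simp [Fin.sum_univ_three]; ring)
      (by intro i _; apply subset_convexHull; fin_cases i <;> simp)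
    simpa [Fin.sum_univ_three] using h

theorem setIntegral_standard_triangle (f : ℝ × ℝ → ℝ) (hf : Continuous f) :
    ∫ p in tri (0, 0) (1, 0) (0, 1), f p =
      ∫ x in (0 : ℝ)..1, ∫ y in (0 : ℝ)..(1 - x), f (x, y) := by
  set H := convexHull ℝ {((0 : ℝ), (0 : ℝ)), (1, 0), (0, 1)} with hH
  have hcomp : IsCompact H :=
    (Set.toFinite {((0 : ℝ), (0 : ℝ)), (1, 0), (0, 1)}).isCompact_convexHull ℝ
  have hae : (tri (0, 0) (1, 0) (0, 1) : Set (ℝ × ℝ)) =ᵐ[volume] H :=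
    interior_ae_eq_of_null_frontier ((convex_convexHull ℝ _ : Convex ℝ H).addHaar_frontier volume)
  have hint : IntegrableOn f H := hf.continuousOn.integrableOn_compact hcomp
  rw [setIntegral_congr_set hae, ← integral_indicator hcomp.measurableSet,
    Measure.volume_eq_prod, integral_prod _ (hint.integrable_indicator hcomp.measurableSet),
    intervalIntegral.integral_of_le zero_le_one, ← integral_Icc_eq_integral_Ioc,
    ← integral_indicator measurableSet_Icc]
  congr 1 with x
  by_cases hx : x ∈ Set.Icc (0 : ℝ) 1
  · rw [Set.indicator_of_mem hx, intervalIntegral.integral_of_le (by linarith [hx.2]),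
      ← integral_Icc_eq_integral_Ioc, ← integral_indicator measurableSet_Icc]
    congr 1 with y
    simp [Set.indicator, hH, convexHull_standard_triangle, hx.1, hx.2]
  · rw [Set.indicator_of_notMem hx]
    have : ∀ y, H.indicator f (x, y) = 0 := fun y =>
      Set.indicator_of_notMem (by
        rw [hH, convexHull_standard_triangle]
        exact fun h => hx h.1) _
    simp [this]

theorem integral_cubic_mul_bubble (c₀ c₁ c₂ c₃ z : ℝ) :
    ∫ t in (0 : ℝ)..z, (c₀ + c₁ * t + c₂ * t ^ 2 + c₃ * t ^ 3) * (t * (z - t)) =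
      c₀ * z ^ 3 / 6 + c₁ * z ^ 4 / 12 + c₂ * z ^ 5 / 20 + c₃ * z ^ 6 / 30 := by
  rw [intervalIntegral.integral_eq_sub_of_hasDerivAt
    (f := fun t => c₀ * (z * t ^ 2 / 2 - t ^ 3 / 3) + c₁ * (z * t ^ 3 / 3 - t ^ 4 / 4)
      + c₂ * (z * t ^ 4 / 4 - t ^ 5 / 5) + c₃ * (z * t ^ 5 / 5 - t ^ 6 / 6))]
  · ring
  · intro t _
    have h (n : ℕ) := hasDerivAt_pow n t
    convert (((((h 2).const_mul z).div_const 2).sub ((h 3).div_const 3)).const_mul c₀).add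
      (((((h 3).const_mul z).div_const 3).sub ((h 4).div_const 4)).const_mul c₁) |>.add
      (((((h 4).const_mul z).div_const 4).sub ((h 5).div_const 5)).const_mul c₂) |>.add
      (((((h 5).const_mul z).div_const 5).sub ((h 6).div_const 6)).const_mul c₃) using 1
    · ext
      simp only [Pi.add_apply, Pi.sub_apply]
    · norm_num
      ring
  · exact Continuous.intervalIntegrable (by fun_prop) _ _

theorem integral_sum_range_mul_pow (n : ℕ) (e : ℕ → ℝ) :
    ∫ z in (0 : ℝ)..1, ∑ i ∈ range n, e i * z ^ i = ∑ i ∈ range n, e i / (i + 1) := by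
  rw [intervalIntegral.integral_finsetSum
    fun i _ => Continuous.intervalIntegrable (by fun_prop) _ _]
  exact sum_congr rfl fun i _ => by
    rw [intervalIntegral.integral_const_mul, integral_pow]
    simp [div_eq_mul_inv]

/-- Moments of the cubic bubble of the standard triangle, up to total degree three. -/
theorem setIntegral_cubic_mul_bubble
    (k₀₀ k₁₀ k₀₁ k₂₀ k₁₁ k₀₂ k₃₀ k₂₁ k₁₂ k₀₃ : ℝ) :
    ∫ p in tri (0, 0) (1, 0) (0, 1),
      (k₀₀ + k₁₀ * p.1 + k₀₁ * p.2 + k₂₀ * p.1 ^ 2 + k₁₁ * (p.1 * p.2) + k₀₂ * p.2 ^ 2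
        + k₃₀ * p.1 ^ 3 + k₂₁ * (p.1 ^ 2 * p.2) + k₁₂ * (p.1 * p.2 ^ 2) + k₀₃ * p.2 ^ 3)
        * (p.1 * p.2 * (1 - p.1 - p.2)) =
      k₀₀ / 120 + (k₁₀ + k₀₁) / 360 + (k₂₀ + k₀₂) / 840 + k₁₁ / 1260
        + (k₃₀ + k₀₃) / 1680 + (k₂₁ + k₁₂) / 3360 := by
  rw [setIntegral_standard_triangle _ (by fun_prop)]
  let G : ℝ → ℝ := fun z : ℝ => (1 - z) * ((k₀₀ + k₁₀ * (1 - z) + k₂₀ * (1 - z) ^ 2 + k₃₀ * (1 - z) ^ 3)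
        * z ^ 3 / 6 + (k₀₁ + k₁₁ * (1 - z) + k₂₁ * (1 - z) ^ 2) * z ^ 4 / 12
        + (k₀₂ + k₁₂ * (1 - z)) * z ^ 5 / 20 + k₀₃ * z ^ 6 / 30)
  have inner (x : ℝ) : (∫ y in (0 : ℝ)..(1 - x),
      (k₀₀ + k₁₀ * x + k₀₁ * y + k₂₀ * x ^ 2 + k₁₁ * (x * y) + k₀₂ * y ^ 2
        + k₃₀ * x ^ 3 + k₂₁ * (x ^ 2 * y) + k₁₂ * (x * y ^ 2) + k₀₃ * y ^ 3)
        * (x * y * (1 - x - y))) = G (1 - x) := by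
    simp only [G]
    rw [← integral_cubic_mul_bubble, ← intervalIntegral.integral_const_mul]
    congr 1 with y
    ring
  rw [intervalIntegral.integral_congr fun x _ => inner x,
    intervalIntegral.integral_comp_sub_left G 1]
  norm_num only [G]
  have h := integral_sum_range_mul_pow 8 (fun i => ![0, 0, 0,
    (k₀₀ + k₁₀ + k₂₀ + k₃₀) / 6,
    -(k₀₀ + 2 * k₁₀ + 3 * k₂₀ + 4 * k₃₀) / 6 + (k₀₁ + k₁₁ + k₂₁) / 12,
    (k₁₀ + 3 * k₂₀ + 6 * k₃₀) / 6 - (k₀₁ + 2 * k₁₁ + 3 * k₂₁) / 12 + (k₀₂ + k₁₂) / 20,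
    -(k₂₀ + 4 * k₃₀) / 6 + (k₁₁ + 3 * k₂₁) / 12 - (k₀₂ + 2 * k₁₂) / 20 + k₀₃ / 30,
    k₃₀ / 6 - k₂₁ / 12 + k₁₂ / 20 - k₀₃ / 30] (Fin.ofNat 8 i))
  simp only [sum_range_succ, Fin.ofNat] at h
  refine (intervalIntegral.integral_congr fun z _ => ?_).trans (h.trans ?_) <;> simp <;> ring

/-- The linear map sending the standard triangle onto the triangle `(0,0), (1,0), (q,p)`. -/
def shearEquiv (q p : ℝ) (hp : p ≠ 0) : (ℝ × ℝ) ≃L[ℝ] (ℝ × ℝ) :=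
  LinearEquiv.toContinuousLinearEquiv
    { toFun := fun x => (x.1 + q * x.2, p * x.2)
      invFun := fun x => (x.1 - q * (x.2 / p), x.2 / p)
      map_add' := fun x y => by ext <;> simp <;> ring
      map_smul' := fun a x => by ext <;> simp <;> ring
      left_inv := fun x => by ext <;> simp [hp]
      right_inv := fun x => by ext <;> simp; field_simp }

@[simp]
theorem shearEquiv_apply (q p : ℝ) (hp : p ≠ 0) (x : ℝ × ℝ) :
    shearEquiv q p hp x = (x.1 + q * x.2, p * x.2) := rfl

theorem shearEquiv_image_tri (q p : ℝ) (hp : p ≠ 0) :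
    shearEquiv q p hp '' tri (0, 0) (1, 0) (0, 1) = tri (1, 0) (0, 0) (q, p) := by
  unfold tri
  have h1 := (shearEquiv q p hp).toHomeomorph.image_interior
    (convexHull ℝ {((0 : ℝ), (0 : ℝ)), (1, 0), (0, 1)})
  have h2 := (shearEquiv q p hp).toLinearEquiv.toLinearMap.image_convexHull
    {((0 : ℝ), (0 : ℝ)), (1, 0), (0, 1)}
  have h3 : (shearEquiv q p hp) '' {((0 : ℝ), (0 : ℝ)), (1, 0), (0, 1)} =
      {((1 : ℝ), (0 : ℝ)), (0, 0), (q, p)} := by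
    simp [Set.image_insert_eq, Set.insert_comm]
  refine h1.trans (congrArg interior (h2.trans ?_))
  exact congrArg _ h3

theorem setIntegral_tri_eq_zero_iff (q p : ℝ) (hp : p ≠ 0) (g : ℝ × ℝ → ℝ) :
    ∫ x in tri (1, 0) (0, 0) (q, p), g x = 0 ↔
      ∫ x in tri (0, 0) (1, 0) (0, 1), g (x.1 + q * x.2, p * x.2) = 0 := by
  rw [← shearEquiv_image_tri q p hp, tri, integral_image_eq_integral_abs_det_fderiv_smul volume
    isOpen_interior.measurableSet
    (fun x _ => (shearEquiv q p hp).hasFDerivAt.hasFDerivWithinAt)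
    (shearEquiv q p hp).injective.injOn, integral_smul, smul_eq_zero, abs_eq_zero]
  have hdet : ((shearEquiv q p hp : (ℝ × ℝ) →L[ℝ] (ℝ × ℝ))).det ≠ 0 :=
    (LinearEquiv.isUnit_det' (shearEquiv q p hp).toLinearEquiv).ne_zero
  simp [hdet]

theorem bubble_standard (x : ℝ × ℝ) :
    bubble (0, 0) (1, 0) (0, 1) x = x.1 * x.2 * (1 - x.1 - x.2) := by
  simp [bubble, bary, det2]
  ring

theorem bubble_shear (q p : ℝ) (hp : p ≠ 0) (x : ℝ × ℝ) :
    bubble (1, 0) (0, 0) (q, p) (x.1 + q * x.2, p * x.2) = x.1 * x.2 * (1 - x.1 - x.2) := by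
  simp [bubble, bary, det2]
  field_simp
  ring

/-- A bivariate polynomial of total degree at most two is determined by six coefficients. -/
theorem exists_quadratic_form (u : MvPolynomial (Fin 2) ℝ) (hu : u.totalDegree ≤ 2) :
    ∃ a : ℕ × ℕ → ℝ,
      u = ∑ k ∈ {(0, 0), (1, 0), (0, 1), (2, 0), (1, 1), (0, 2)},
        MvPolynomial.C (a k) * MvPolynomial.X 0 ^ k.1 * MvPolynomial.X 1 ^ k.2 := by
  classical
  let f : ℕ × ℕ → (Fin 2 →₀ ℕ) := fun k => Finsupp.single 0 k.1 + Finsupp.single 1 k.2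
  have hf : Function.Injective f := by
    intro k l h
    have h0 := DFunLike.congr_fun h 0
    have h1 := DFunLike.congr_fun h 1
    simp [f] at h0 h1
    exact Prod.ext h0 h1
  let S : Finset (ℕ × ℕ) := {(0, 0), (1, 0), (0, 1), (2, 0), (1, 1), (0, 2)}
  refine ⟨fun k => u.coeff (f k), ?_⟩
  have hsub : u.support ⊆ S.image f := by
    intro m hm
    have h := (MvPolynomial.le_totalDegree hm).trans hu
    rw [Finsupp.sum_fintype _ _ (by simp), Fin.sum_univ_two] at h
    refine mem_image.2 ⟨(m 0, m 1), ?_, ?_⟩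
    · generalize m 0 = i at *
      generalize m 1 = j at *
      have hi : i ≤ 2 := by omega
      have hj : j ≤ 2 := by omega
      interval_cases i <;> interval_cases j <;> simp [S] at h ⊢
    · ext i
      fin_cases i <;> simp [f]
  conv_lhs => rw [u.as_sum]
  rw [sum_subset hsub (by
    intro m _ hm
    rw [MvPolynomial.notMem_support_iff.1 hm, map_zero]), sum_image hf.injOn]
  refine sum_congr rfl fun k _ => ?_
  rw [MvPolynomial.monomial_eq, Finsupp.prod_fintype _ _ (by simp), Fin.prod_univ_two]
  simp [f, mul_assoc]

/-- Orthogonality of a quadratic to affine functions on the standard triangle, expressed through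
its coefficients. -/
theorem coeff_eq_of_orthogonal (a b c r s t : ℝ)
    (h : ∀ m₀ m₁ m₂ : ℝ, ∫ x in tri (0, 0) (1, 0) (0, 1),
      (a + b * x.1 + c * x.2 + r * x.1 ^ 2 + s * (x.1 * x.2) + t * x.2 ^ 2)
        * (m₀ + m₁ * x.1 + m₂ * x.2) * (x.1 * x.2 * (1 - x.1 - x.2)) = 0) :
    b = -(3 * r + s) / 4 ∧ c = -(3 * t + s) / 4 ∧ a = (3 * r + 2 * s + 3 * t) / 28 := by
  have key (m₀ m₁ m₂ : ℝ) := (setIntegral_cubic_mul_bubble (a * m₀) (b * m₀ + a * m₁)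
    (c * m₀ + a * m₂) (r * m₀ + b * m₁) (s * m₀ + c * m₁ + b * m₂) (t * m₀ + c * m₂)
    (r * m₁) (s * m₁ + r * m₂) (t * m₁ + s * m₂) (t * m₂)).symm.trans
    ((integral_congr_ae (.of_forall fun x => by ring)).trans (h m₀ m₁ m₂))
  have e0 := key 1 0 0
  have e1 := key 0 1 0
  have e2 := key 0 0 1
  refine ⟨?_, ?_, ?_⟩ <;> linarith

/-- A quadratic orthogonal to the affine functions on both triangles has vanishing leading
part. -/
theorem leading_coeff_eq_zero (q p r s t : ℝ) (hq : q ≠ 0) (hp1 : p ≠ 1) (hp2 : p ≠ -1)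
    (hpq : p + q ≠ 1)
    (h1 : 2 * q * r + (p - 1) * s = 0)
    (h2 : q ^ 2 * r + p * q * s + (p ^ 2 - 1) * t = 0)
    (h3 : 3 * q * r + (q + p - 1) * s + 3 * (p - 1) * t = 0) :
    r = 0 ∧ s = 0 ∧ t = 0 := by
  have hp1' : p - 1 ≠ 0 := sub_ne_zero.2 hp1
  have hp2' : p + 1 ≠ 0 := fun h => hp2 (by linarith)
  have hpq' : p + q - 1 ≠ 0 := sub_ne_zero.2 hpq
  have hs : s = 0 := by
    have : (p + 1) * (p + q - 1) * s = 0 := by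
      linear_combination -3 * (q - p - 1) * h1 + 6 * h2 - 2 * (p + 1) * h3
    simpa [hp2', hpq'] using this
  subst hs
  have hr : r = 0 := by simpa [hq] using h1
  subst hr
  exact ⟨rfl, rfl, by simpa [hp1'] using h3⟩

/-- For reals `c ≠ d` with `c ≠ 0`, `d ≠ 1`, `d - c ≠ 1` and `d - c ≠ -1`,
the intersection `P_1^⊥(T₁) ∩ P_1^⊥(K_{c,d})` (inside the bivariate polynomials of total
degree at most `2`) is `{0}`. -/
theorem statement7 (c d : ℝ) (hcd : c ≠ d) (hc : c ≠ 0) (hd : d ≠ 1)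
    (h1 : d - c ≠ 1) (h2 : d - c ≠ -1) (u : MvPolynomial (Fin 2) ℝ)
    (hT : inPerp 2 (0, 0) (1, 0) (0, 1) u)
    (hK : inPerp 2 (1, 0) (0, 0) (-c / (d - c), 1 / (d - c)) u) :
    u = 0 := by
  have hdc : d - c ≠ 0 := sub_ne_zero.2 hcd.symm
  obtain ⟨q, hq⟩ : ∃ q, q = -c / (d - c) := ⟨_, rfl⟩
  obtain ⟨p, hp⟩ : ∃ p, p = 1 / (d - c) := ⟨_, rfl⟩
  have hq0 : q ≠ 0 := hq ▸ div_ne_zero (neg_ne_zero.2 hc) hdc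
  have hp0 : p ≠ 0 := hp ▸ one_div_ne_zero hdc
  have hp1 : p ≠ 1 := by
    rw [hp, Ne, div_eq_iff hdc]
    exact fun h => h1 (by linarith)
  have hp2 : p ≠ -1 := by
    rw [hp, Ne, div_eq_iff hdc]
    exact fun h => h2 (by linarith)
  have hpq : p + q ≠ 1 := by
    rw [hp, hq, ← add_div, Ne, div_eq_iff hdc]
    exact fun h => hd (by linarith)
  rw [← hq, ← hp] at hK
  obtain ⟨a, ha⟩ := exists_quadratic_form u hT.1
  let w (m₀ m₁ m₂ : ℝ) : MvPolynomial (Fin 2) ℝ :=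
    MvPolynomial.C m₀ + MvPolynomial.C m₁ * MvPolynomial.X 0
      + MvPolynomial.C m₂ * MvPolynomial.X 1
  have hw (m₀ m₁ m₂ : ℝ) : (w m₀ m₁ m₂).totalDegree ≤ 2 - 1 := by
    have hX (m : ℝ) (i : Fin 2) :
        (MvPolynomial.C m * MvPolynomial.X i : MvPolynomial (Fin 2) ℝ).totalDegree ≤ 1 :=
      (MvPolynomial.totalDegree_mul _ _).trans (by simp)
    refine (MvPolynomial.totalDegree_add _ _).trans (max_le ?_ (hX _ _))
    exact (MvPolynomial.totalDegree_add _ _).trans (max_le (by simp) (hX _ _))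
  have hwe (m₀ m₁ m₂ : ℝ) (x : ℝ × ℝ) :
      evalP (w m₀ m₁ m₂) x = m₀ + m₁ * x.1 + m₂ * x.2 := by
    simp [w, evalP]
  have hue (x : ℝ × ℝ) : evalP u x = a (0, 0) + a (1, 0) * x.1 + a (0, 1) * x.2
      + a (2, 0) * x.1 ^ 2 + a (1, 1) * (x.1 * x.2) + a (0, 2) * x.2 ^ 2 := by
    rw [ha]
    simp [evalP]
    ring
  obtain ⟨e1, e2, e3⟩ := coeff_eq_of_orthogonal (a (0, 0)) (a (1, 0)) (a (0, 1)) (a (2, 0))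
    (a (1, 1)) (a (0, 2)) fun m₀ m₁ m₂ => by
      simpa only [innerT, hue, hwe, bubble_standard] using hT.2 (w m₀ m₁ m₂) (hw _ _ _)
  obtain ⟨f1, f2, f3⟩ := coeff_eq_of_orthogonal (a (0, 0)) (a (1, 0))
    (a (1, 0) * q + a (0, 1) * p) (a (2, 0)) (2 * q * a (2, 0) + p * a (1, 1))
    (q ^ 2 * a (2, 0) + p * q * a (1, 1) + p ^ 2 * a (0, 2)) fun m₀ m₁ m₂ => by
      have h := hK.2 (w m₀ m₁ ((m₂ - q * m₁) / p)) (hw _ _ _)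
      rw [innerT, setIntegral_tri_eq_zero_iff q p hp0] at h
      simp only [hue, hwe, bubble_shear q p hp0] at h
      refine (integral_congr_ae (.of_forall fun x => ?_)).trans h
      field_simp
      ring
  obtain ⟨hr, hs, ht⟩ := leading_coeff_eq_zero q p (a (2, 0)) (a (1, 1)) (a (0, 2))
    hq0 hp1 hp2 hpq (by linarith) (by linarith)
    (by linear_combination -4 * f2 + 4 * q * e1 + 4 * p * e2 + 28 * e3 - 28 * f3
      + 4 * e1 - 4 * f1)
  have h00 : a (0, 0) = 0 := by rw [e3, hr, hs, ht]; norm_num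
  have h10 : a (1, 0) = 0 := by rw [e1, hr, hs]; norm_num
  have h01 : a (0, 1) = 0 := by rw [e2, ht, hs]; norm_num
  rw [ha]
  simp [hr, hs, ht, h00, h10, h01]
end
end
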